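/- Let k ≥ 1, X ∈ FIN_k^[∞], s ∈ A X, and let c : [s, X] → l (l ∈ ℕ) be a finite Suslin-measurable coloring. Then there exists Y ∈ [s, X] such that c is constant on [s, Y]. -/

import Mathlib

open scoped Classical

/-- `x` is a `k`-vector: values `≤ k`, finite support, attains the value `k`. -/
def IsFin (k : ℕ) (x : ℕ → ℕ) : Prop :=
  (∀ n, x n ≤ k) ∧ {n | x n ≠ 0}.Finite ∧ ∃ n, x n = k

/-- `x < y` as blocks: every point of the support of `x` lies below every
point of the support of `y`. -/
def VecLt (x y : ℕ → ℕ) : Prop := ∀ m n, x m ≠ 0 → y n ≠ 0 → m < n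

/-- An infinite block sequence of `k`-vectors. -/
def IsBlockSeq (k : ℕ) (X : ℕ → ℕ → ℕ) : Prop :=
  (∀ n, IsFin k (X n)) ∧ ∀ n, VecLt (X n) (X (n + 1))

/-- `T^i x (n) = max (x n - i) 0` (truncated subtraction on `ℕ`). -/
def Tmap (i : ℕ) (x : ℕ → ℕ) : ℕ → ℕ := fun n => x n - i

/-- `w` lies in the combinatorial subspace generated by the terms `X n`, `n ∈ I`:
it is a sum `T^{e n₀} x_{n₀} + ⋯ + T^{e nₘ} x_{nₘ}` with all `e n ≤ k` and at
least one `e n = 0`. -/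
def InSubspaceOn (k : ℕ) (X : ℕ → ℕ → ℕ) (I : Set ℕ) (w : ℕ → ℕ) : Prop :=
  ∃ (s : Finset ℕ) (e : ℕ → ℕ), ↑s ⊆ I ∧ s.Nonempty ∧ (∀ n ∈ s, e n ≤ k) ∧
    (∃ n ∈ s, e n = 0) ∧ w = fun m => ∑ n ∈ s, Tmap (e n) (X n) m

/-- `w ∈ ⟨X⟩`. -/
def InSubspace (k : ℕ) (X : ℕ → ℕ → ℕ) (w : ℕ → ℕ) : Prop :=
  InSubspaceOn k X Set.univ w

/-- `Y ≤ X` : `Y` is a block sequence all of whose terms lie in `⟨X⟩`. -/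
def BlockLE (k : ℕ) (Y X : ℕ → ℕ → ℕ) : Prop :=
  IsBlockSeq k Y ∧ ∀ n, InSubspace k X (Y n)

/-- `r_n(X)`, the first `n` terms of `X`, as a list. -/
def restrictN (X : ℕ → ℕ → ℕ) (n : ℕ) : List (ℕ → ℕ) := (List.range n).map X

/-- `𝒜X_n = { r_n(Y) : Y ≤ X }`. -/
def ApproxN (k : ℕ) (X : ℕ → ℕ → ℕ) (n : ℕ) : Set (List (ℕ → ℕ)) :=
  {s | ∃ Y, BlockLE k Y X ∧ s = restrictN Y n}

/-- `𝒜X = ⋃ n, 𝒜X_n`. -/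
def Approx (k : ℕ) (X : ℕ → ℕ → ℕ) : Set (List (ℕ → ℕ)) :=
  ⋃ n, ApproxN k X n

/-- `F` is a front on `[∅, X]`. -/
def IsFront (k : ℕ) (X : ℕ → ℕ → ℕ) (F : Set (List (ℕ → ℕ))) : Prop :=
  F ⊆ Approx k X ∧ (∀ Y, BlockLE k Y X → ∃ n, restrictN Y n ∈ F) ∧
    ∀ s ∈ F, ∀ t ∈ F, s <+: t → s = t

/-- `F̂` : the set of initial segments of members of `F`. -/
def FrontHat (F : Set (List (ℕ → ℕ))) : Set (List (ℕ → ℕ)) :=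
  {t | ∃ s ∈ F, t <+: s}

/-- `x` lies beyond (the supports of) all terms of the finite block sequence `s`. -/
def AfterList (s : List (ℕ → ℕ)) (x : ℕ → ℕ) : Prop := ∀ y ∈ s, VecLt y x

/-- `X` separates `s` and `t` (with respect to the coloring `f` of the front `F`):
whenever `s⌢w, t⌢v ∈ F↾X` with `w` from `⟨X/s⟩` and `v` from `⟨X/t⟩`,
the `f`-colors differ. -/
def Separates {α : Type*} (k : ℕ) (f : List (ℕ → ℕ) → α) (F : Set (List (ℕ → ℕ)))
    (X : ℕ → ℕ → ℕ) (s t : List (ℕ → ℕ)) : Prop :=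
  ∀ w v : List (ℕ → ℕ),
    (∀ x ∈ w, InSubspace k X x ∧ AfterList s x) →
    (∀ x ∈ v, InSubspace k X x ∧ AfterList t x) →
    s ++ w ∈ F → s ++ w ∈ Approx k X →
    t ++ v ∈ F → t ++ v ∈ Approx k X →
    f (s ++ w) ≠ f (t ++ v)

/-- `X` mixes `s` with `t` : no `Y ≤ X` separates `s` and `t`. -/
def Mixes {α : Type*} (k : ℕ) (f : List (ℕ → ℕ) → α) (F : Set (List (ℕ → ℕ)))
    (X : ℕ → ℕ → ℕ) (s t : List (ℕ → ℕ)) : Prop :=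
  ∀ Y, BlockLE k Y X → ¬ Separates k f F Y s t

/-- `depth_X(s)` : the least `n` with `s ≤ r_n(X)` (`∞` if none exists); this least
`n` is exactly the unique `n` with `s ≤_fin r_n(X)`. -/
noncomputable def depth (k : ℕ) (X : ℕ → ℕ → ℕ) (s : List (ℕ → ℕ)) : ℕ∞ :=
  sInf {m : ℕ∞ | ∃ n : ℕ, m = (n : ℕ∞) ∧ ∀ x ∈ s, InSubspaceOn k X (Set.Iio n) x}

/-- `min_i w` : the least point where `w` takes the value `i` (junk value if none). -/
noncomputable def minIdx (i : ℕ) (w : ℕ → ℕ) : ℕ := sInf {n | w n = i}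

/-- `max_i w` : the largest point where `w` takes the value `i` (junk value if none). -/
noncomputable def maxIdx (i : ℕ) (w : ℕ → ℕ) : ℕ := sSup {n | w n = i}

/-- The vector with value `i` at `min_i w` and `0` elsewhere. -/
noncomputable def minVec (i : ℕ) (w : ℕ → ℕ) : ℕ → ℕ :=
  fun n => if n = minIdx i w then i else 0

/-- The vector with value `i` at `max_i w` and `0` elsewhere. -/
noncomputable def maxVec (i : ℕ) (w : ℕ → ℕ) : ℕ → ℕ :=
  fun n => if n = maxIdx i w then i else 0

/-- `θ⁰_{i,l}(w) = {(n,l) : n ∈ (min_i w, min_{i+1} w), w n = l}`. -/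
noncomputable def theta0 (i l : ℕ) (w : ℕ → ℕ) : ℕ → ℕ :=
  fun n => if minIdx i w < n ∧ n < minIdx (i + 1) w ∧ w n = l then l else 0

/-- `θ¹_{i,l}(w) = {(n,l) : n ∈ (max_{i+1} w, max_i w), w n = l}`. -/
noncomputable def theta1 (i l : ℕ) (w : ℕ → ℕ) : ℕ → ℕ :=
  fun n => if maxIdx (i + 1) w < n ∧ n < maxIdx i w ∧ w n = l then l else 0

/-- `θ²_l(w) = {(n,l) : n ∈ (min_k w, max_k w), w n = l}`. -/
noncomputable def theta2 (k l : ℕ) (w : ℕ → ℕ) : ℕ → ℕ :=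
  fun n => if minIdx k w < n ∧ n < maxIdx k w ∧ w n = l then l else 0

def Gmin (k : ℕ) : Set ((ℕ → ℕ) → ℕ → ℕ) := {g | ∃ i, 1 ≤ i ∧ i ≤ k ∧ g = minVec i}
def Gmax (k : ℕ) : Set ((ℕ → ℕ) → ℕ → ℕ) := {g | ∃ i, 1 ≤ i ∧ i ≤ k ∧ g = maxVec i}
def Gmid0 (k : ℕ) : Set ((ℕ → ℕ) → ℕ → ℕ) :=
  {g | ∃ i l, 1 ≤ i ∧ i ≤ k - 1 ∧ 1 ≤ l ∧ l ≤ i - 1 ∧ g = theta0 i l}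
def Gmid1 (k : ℕ) : Set ((ℕ → ℕ) → ℕ → ℕ) :=
  {g | ∃ i l, 1 ≤ i ∧ i ≤ k - 1 ∧ 1 ≤ l ∧ l ≤ i - 1 ∧ g = theta1 i l}
def Gmid (k : ℕ) : Set ((ℕ → ℕ) → ℕ → ℕ) :=
  {g | (∃ l, 1 ≤ l ∧ l ≤ k ∧ g = theta2 k l) ∨ g = fun _ _ => 0}

/-- The family `𝒢` of elementary staircase maps. -/
def Gfam (k : ℕ) : Set ((ℕ → ℕ) → ℕ → ℕ) :=
  Gmin k ∪ Gmax k ∪ Gmid0 k ∪ Gmid1 k ∪ Gmid k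

/-- A staircase function : a member of the lattice closure of `𝒢` under the
pointwise join `(f ∨ g)(w) = f(w) ∨ g(w)`. -/
inductive IsStaircase (k : ℕ) : ((ℕ → ℕ) → ℕ → ℕ) → Prop
  | base (g : (ℕ → ℕ) → ℕ → ℕ) (hg : g ∈ Gfam k) : IsStaircase k g
  | join (f g : (ℕ → ℕ) → ℕ → ℕ) (hf : IsStaircase k f) (hg : IsStaircase k g) :
      IsStaircase k (fun w n => max (f w n) (g w n))

/-- `x` is a system of staircases (sos). -/
def IsSos (k : ℕ) (x : ℕ → ℕ) : Prop :=
  IsFin k x ∧ Set.range x = Set.Iic k ∧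
  (∀ i j, 1 ≤ i → i < j → j ≤ k → minIdx i x < minIdx j x ∧ minIdx j x < maxIdx i x) ∧
  ∀ i, 1 ≤ i → i ≤ k →
    x '' Set.Ico (minIdx (i - 1) x) (minIdx i x) = Set.Iic (i - 1) ∧
    x '' Set.Ioc (maxIdx i x) (maxIdx (i - 1) x) = Set.Iic (i - 1) ∧
    x '' Set.Icc (minIdx k x) (maxIdx k x) = Set.Iic k

/-- `x ⊆ y` as sets of ordered pairs `{(n, x n) : x n ≠ 0}`. -/
def VecSub (x y : ℕ → ℕ) : Prop := ∀ n, x n ≠ 0 → x n = y n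

/-- `a` is contained in `b` coordinatewise (as sets of ordered pairs), after
matching `a` with a sublist of `b` of the same length. -/
def ListInner (a b : List (ℕ → ℕ)) : Prop :=
  ∃ b' : List (ℕ → ℕ), b'.Sublist b ∧ a.length = b'.length ∧
    ∀ i < a.length, VecSub (a.getD i (fun _ => 0)) (b'.getD i (fun _ => 0))

/-- The value `φ_s(w)` for a family of (possibly empty) maps `Φ`. -/
def phiVal (Φ : List (ℕ → ℕ) → Option ((ℕ → ℕ) → ℕ → ℕ)) (s : List (ℕ → ℕ))
    (w : ℕ → ℕ) : Option (ℕ → ℕ) :=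
  (Φ s).map fun g => g w

/-- The inner map `φ(s) = ⋃_{s' ⊑ s} φ_{s'}(s(|s'|))`, the concatenation of the
values `φ_{r_i(s)}(s(i))` over those `i < |s|` with `φ_{r_i(s)} ≠ ∅`. -/
def innerMap (Φ : List (ℕ → ℕ) → Option ((ℕ → ℕ) → ℕ → ℕ)) (s : List (ℕ → ℕ)) :
    List (ℕ → ℕ) :=
  (List.range s.length).filterMap fun i =>
    (Φ (s.take i)).map fun g => g (s.getD i (fun _ => 0))

/-- `X` weakly mixes `s` with `t`, witnessed by the vector `w` (`w = w_s^t`). -/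
def WeaklyMixesWith (k : ℕ) (f : List (ℕ → ℕ) → ℕ) (F : Set (List (ℕ → ℕ)))
    (X : ℕ → ℕ → ℕ) (s t : List (ℕ → ℕ)) (w : ℕ → ℕ) : Prop :=
  depth k X s < depth k X t ∧ w ∈ t ∧ w ∉ s ∧
  ∀ Y, BlockLE k Y X →
    (∃ Z, BlockLE k Z Y ∧ restrictN Z s.length = s) →
    (∃ Z, BlockLE k Z Y ∧ restrictN Z t.length = t) →
    ∃ sbar tbar : List (ℕ → ℕ), sbar ∈ F ∩ Approx k Y ∧ tbar ∈ F ∩ Approx k Y ∧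
      t <+: tbar ∧
      (∃ v, InSubspace k Y v ∧ VecLt w v ∧ (s ++ [fun n => w n + v n]) <+: sbar) ∧
      f sbar = f tbar

/-- `c` is a tuple of combinations `T^{i_0} t_{i_0} + ⋯ + T^{i_l} t_{i_l}` of the
terms of `t`, lying in `⟨X⟩`, with pairwise disjoint sets of indices (each term
of `t` appears in at most one combination). -/
def IsComb (k : ℕ) (X : ℕ → ℕ → ℕ) (t c : List (ℕ → ℕ)) : Prop :=
  ∃ (I : ℕ → Finset ℕ) (e : ℕ → ℕ → ℕ),
    (∀ m < c.length,
      (I m).Nonempty ∧ (∀ j ∈ I m, j < t.length) ∧ (∀ j ∈ I m, e m j ≤ k) ∧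
      (∃ j ∈ I m, e m j = 0) ∧
      c.getD m (fun _ => 0) =
        (fun n => ∑ j ∈ I m, Tmap (e m j) (t.getD j (fun _ => 0)) n) ∧
      InSubspace k X (c.getD m (fun _ => 0))) ∧
    ∀ m < c.length, ∀ m' < c.length, m ≠ m' → Disjoint (I m) (I m')

/-- The Suslin operation applied to a scheme indexed by finite sequences. -/
def SuslinOp {α : Type*} (P : List ℕ → Set α) : Set α :=
  ⋃ x : ℕ → ℕ, ⋂ n : ℕ, P ((List.range n).map x)

/-- The basic (open) sets `[s, X]` of the space `FIN_k^[∞]`. -/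
def BasicOpen (k : ℕ) : Set (Set (ℕ → ℕ → ℕ)) :=
  {B | ∃ (s : List (ℕ → ℕ)) (X : ℕ → ℕ → ℕ), IsBlockSeq k X ∧ s ∈ Approx k X ∧
    B = {Y | BlockLE k Y X ∧ restrictN Y s.length = s}}

/-- The topology on `FIN_k^[∞]` generated by the basic sets `[s, X]`. -/
def finkTop (k : ℕ) : TopologicalSpace (ℕ → ℕ → ℕ) :=
  TopologicalSpace.generateFrom (BasicOpen k)

/-- The smallest σ-field containing the closed sets and closed under the
Suslin operation. -/
inductive InSuslinField {α : Type*} (T : TopologicalSpace α) : Set α → Prop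
  | closed (s : Set α) (hs : @IsClosed α T s) : InSuslinField T s
  | compl (s : Set α) (hs : InSuslinField T s) : InSuslinField T sᶜ
  | iUnion (g : ℕ → Set α) (hg : ∀ n, InSuslinField T (g n)) : InSuslinField T (⋃ n, g n)
  | suslin (P : List ℕ → Set α) (hP : ∀ u, InSuslinField T (P u)) :
      InSuslinField T (SuslinOp P)

namespace BlockSpace

variable {k : ℕ}

theorem IsFin.exists_peak {x : ℕ → ℕ} (hk : 1 ≤ k) (hx : IsFin k x) : ∃ p, x p = k ∧ x p ≠ 0 := by
  obtain ⟨p, hp⟩ := hx.2.2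
  exact ⟨p, hp, by omega⟩

theorem IsBlockSeq.vecLt (hk : 1 ≤ k) {W : ℕ → ℕ → ℕ} (hW : IsBlockSeq k W) {m n : ℕ}
    (h : m < n) : VecLt (W m) (W n) := by
  induction n, h using Nat.le_induction with
  | base => exact hW.2 m
  | succ n hn ih =>
    intro p q hp hq
    obtain ⟨r, -, hr⟩ := IsFin.exists_peak hk (hW.1 n)
    exact (ih p r hp hr).trans (hW.2 n r q hr hq)

theorem IsBlockSeq.index_unique (hk : 1 ≤ k) {W : ℕ → ℕ → ℕ} (hW : IsBlockSeq k W) {m n p : ℕ}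
    (hm : W m p ≠ 0) (hn : W n p ≠ 0) : m = n := by
  rcases lt_trichotomy m n with h | h | h
  · exact absurd (IsBlockSeq.vecLt hk hW h p p hm hn) (lt_irrefl _)
  · exact h
  · exact absurd (IsBlockSeq.vecLt hk hW h p p hn hm) (lt_irrefl _)

theorem IsBlockSeq.index_le (hk : 1 ≤ k) {W : ℕ → ℕ → ℕ} (hW : IsBlockSeq k W) {n p : ℕ}
    (hp : W n p ≠ 0) : n ≤ p := by
  induction n generalizing p with
  | zero => exact Nat.zero_le _
  | succ n ih =>
    obtain ⟨r, -, hr⟩ := IsFin.exists_peak hk (hW.1 n)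
    exact (ih hr).trans_lt (hW.2 n r p hr hp)

/-- The combination `∑ T^{k - f n} W_n` of the block sequence `W`. -/
noncomputable def combine (k : ℕ) (W : ℕ → ℕ → ℕ) (f : ℕ → ℕ) : ℕ → ℕ := fun p =>
  if h : ∃ n, W n p ≠ 0 then W h.choose p - (k - f h.choose) else 0

theorem combine_of_ne (hk : 1 ≤ k) {W : ℕ → ℕ → ℕ} (hW : IsBlockSeq k W) (f : ℕ → ℕ) {n p : ℕ}
    (h : W n p ≠ 0) : combine k W f p = W n p - (k - f n) := by
  have h' : ∃ n, W n p ≠ 0 := ⟨n, h⟩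
  have := IsBlockSeq.index_unique hk hW h'.choose_spec h
  simp only [combine, dif_pos h']
  rw [this]

theorem combine_of_forall_eq {W : ℕ → ℕ → ℕ} (f : ℕ → ℕ) {p : ℕ}
    (h : ∀ n, W n p = 0) : combine k W f p = 0 := by
  have h' : ¬ ∃ n, W n p ≠ 0 := by simpa using h
  simp only [combine, dif_neg h']

theorem combine_ne_zero (hk : 1 ≤ k) {W : ℕ → ℕ → ℕ} (hW : IsBlockSeq k W) {f : ℕ → ℕ} {p : ℕ}
    (h : combine k W f p ≠ 0) : ∃ n, f n ≠ 0 ∧ W n p ≠ 0 := by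
  by_cases h' : ∃ n, W n p ≠ 0
  · obtain ⟨n, hn⟩ := h'
    rw [combine_of_ne hk hW f hn] at h
    have := (hW.1 n).1 p
    exact ⟨n, by omega, hn⟩
  · exact absurd (combine_of_forall_eq f (by simpa using h')) h

theorem inSubspaceOn_iff (hk : 1 ≤ k) {W : ℕ → ℕ → ℕ} (hW : IsBlockSeq k W) {I : Set ℕ}
    {w : ℕ → ℕ} : InSubspaceOn k W I w ↔
      ∃ f, IsFin k f ∧ (∀ n, f n ≠ 0 → n ∈ I) ∧ w = combine k W f := by
  constructor
  · rintro ⟨s, e, hs, -, hle, ⟨n₀, hn₀, he₀⟩, rfl⟩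
    refine ⟨fun n => if n ∈ s then k - e n else 0, ⟨fun n => ?_, ?_, n₀, by simp [hn₀, he₀]⟩,
      fun n hn => ?_, ?_⟩
    · dsimp only
      split_ifs <;> omega
    · refine s.finite_toSet.subset fun n hn => ?_
      by_contra h
      exact hn (if_neg h)
    · by_contra h
      exact hn (if_neg fun h' => h (hs h'))
    · funext p
      by_cases h : ∃ n, W n p ≠ 0
      · obtain ⟨n, hn⟩ := h
        rw [combine_of_ne hk hW _ hn]
        have hz : ∀ b ∈ s, b ≠ n → Tmap (e b) (W b) p = 0 := by
          intro b _ hb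
          have : W b p = 0 := by
            by_contra h
            exact hb (IsBlockSeq.index_unique hk hW h hn)
          simp [Tmap, this]
        by_cases hns : n ∈ s
        · rw [Finset.sum_eq_single_of_mem n hns hz]
          have := hle n hns
          simp only [Tmap, if_pos hns]
          omega
        · rw [Finset.sum_eq_zero fun b hb => hz b hb (by rintro rfl; exact hns hb)]
          have := (hW.1 n).1 p
          simp only [if_neg hns]
          omega
      · push Not at h
        rw [combine_of_forall_eq _ h]
        exact Finset.sum_eq_zero fun b _ => by simp [Tmap, h b]
  · rintro ⟨f, hf, hI, rfl⟩
    obtain ⟨n₀, hn₀⟩ := hf.2.2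
    have hm : ∀ n, n ∈ hf.2.1.toFinset ↔ f n ≠ 0 := fun n => by simp
    have hn₀' : n₀ ∈ hf.2.1.toFinset := by rw [hm]; omega
    refine ⟨hf.2.1.toFinset, fun n => k - f n, fun n hn => hI n ?_, ⟨n₀, hn₀'⟩,
      fun n _ => Nat.sub_le _ _, ⟨n₀, hn₀', by dsimp only; omega⟩, ?_⟩
    · exact (hm n).1 hn
    · funext p
      by_cases h : ∃ n, W n p ≠ 0
      · obtain ⟨n, hn⟩ := h
        rw [combine_of_ne hk hW _ hn]
        have hz : ∀ b, b ≠ n → Tmap (k - f b) (W b) p = 0 := by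
          intro b hb
          have : W b p = 0 := by
            by_contra h
            exact hb (IsBlockSeq.index_unique hk hW h hn)
          simp [Tmap, this]
        rw [Finset.sum_eq_single n (fun b _ => hz b)]
        · rfl
        · intro hns
          have h0 : f n = 0 := by simpa using hns
          have := (hW.1 n).1 p
          simp only [Tmap]
          omega
      · push Not at h
        rw [combine_of_forall_eq _ h]
        exact (Finset.sum_eq_zero fun b _ => by simp [Tmap, h b]).symm

theorem inSubspace_iff (hk : 1 ≤ k) {W : ℕ → ℕ → ℕ} (hW : IsBlockSeq k W) {w : ℕ → ℕ} :
    InSubspace k W w ↔ ∃ f, IsFin k f ∧ w = combine k W f := by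
  rw [InSubspace, inSubspaceOn_iff hk hW]
  simp

theorem InSubspaceOn.mono {W : ℕ → ℕ → ℕ} {I J : Set ℕ} (hIJ : I ⊆ J) {w : ℕ → ℕ}
    (h : InSubspaceOn k W I w) : InSubspaceOn k W J w := by
  obtain ⟨s, e, hs, h⟩ := h
  exact ⟨s, e, hs.trans hIJ, h⟩

theorem isFin_combine (hk : 1 ≤ k) {W : ℕ → ℕ → ℕ} (hW : IsBlockSeq k W) {f : ℕ → ℕ}
    (hf : IsFin k f) : IsFin k (combine k W f) := by
  refine ⟨fun p => ?_, ?_, ?_⟩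
  · by_cases h : ∃ n, W n p ≠ 0
    · obtain ⟨n, hn⟩ := h
      rw [combine_of_ne hk hW f hn]
      exact (Nat.sub_le _ _).trans ((hW.1 n).1 p)
    · rw [combine_of_forall_eq f (by simpa using h)]
      exact Nat.zero_le _
  · refine (hf.2.1.biUnion fun n _ => (hW.1 n).2.1).subset fun p hp => ?_
    obtain ⟨n, hn, hn'⟩ := combine_ne_zero hk hW hp
    exact Set.mem_biUnion hn hn'
  · obtain ⟨n, hn⟩ := hf.2.2
    obtain ⟨p, hp, hp'⟩ := IsFin.exists_peak hk (hW.1 n)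
    exact ⟨p, by rw [combine_of_ne hk hW f hp', hn, hp]; omega⟩

theorem vecLt_combine (hk : 1 ≤ k) {W : ℕ → ℕ → ℕ} (hW : IsBlockSeq k W) {f g : ℕ → ℕ}
    (h : VecLt f g) : VecLt (combine k W f) (combine k W g) := by
  intro p q hp hq
  obtain ⟨m, hm, hm'⟩ := combine_ne_zero hk hW hp
  obtain ⟨n, hn, hn'⟩ := combine_ne_zero hk hW hq
  exact IsBlockSeq.vecLt hk hW (h m n hm hn) p q hm' hn'

theorem vecLt_of_combine (hk : 1 ≤ k) {W : ℕ → ℕ → ℕ} (hW : IsBlockSeq k W) {f g : ℕ → ℕ}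
    (hf : IsFin k f) (hg : IsFin k g) (h : VecLt (combine k W f) (combine k W g)) :
    VecLt f g := by
  intro m n hm hn
  choose π hπ hπ' using fun i => IsFin.exists_peak hk (hW.1 i)
  have key : π m < π n := by
    have := hf.1 m
    have := hg.1 n
    apply h
    · rw [combine_of_ne hk hW f (hπ' m), hπ]; omega
    · rw [combine_of_ne hk hW g (hπ' n), hπ]; omega
  rcases lt_trichotomy m n with h | h | h
  · exact h
  · subst h; omega
  · have := IsBlockSeq.vecLt hk hW h _ _ (hπ' n) (hπ' m)
    omega

theorem isBlockSeq_combine (hk : 1 ≤ k) {W Z : ℕ → ℕ → ℕ} (hW : IsBlockSeq k W)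
    (hZ : IsBlockSeq k Z) : IsBlockSeq k fun n => combine k W (Z n) :=
  ⟨fun n => isFin_combine hk hW (hZ.1 n), fun n => vecLt_combine hk hW (hZ.2 n)⟩

theorem combine_combine (hk : 1 ≤ k) {W Z : ℕ → ℕ → ℕ} (hW : IsBlockSeq k W)
    (hZ : IsBlockSeq k Z) {f : ℕ → ℕ} (hf : IsFin k f) :
    combine k (fun n => combine k W (Z n)) f = combine k W (combine k Z f) := by
  have hY := isBlockSeq_combine hk hW hZ
  funext p
  by_cases h : ∃ n, W n p ≠ 0
  · obtain ⟨n, hn⟩ := h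
    rw [combine_of_ne hk hW _ hn]
    have hWn := (hW.1 n).1 p
    by_cases hm : ∃ m, Z m n ≠ 0
    · obtain ⟨m, hm⟩ := hm
      have hZm := (hZ.1 m).1 n
      have hfm := hf.1 m
      rw [combine_of_ne hk hZ _ hm]
      by_cases hp : combine k W (Z m) p = 0
      · rw [combine_of_forall_eq]
        · rw [combine_of_ne hk hW _ hn] at hp
          omega
        · intro m'
          by_cases hmm : m' = m
          · rw [hmm, hp]
          · have : Z m' n = 0 := by
              by_contra h
              exact hmm (IsBlockSeq.index_unique hk hZ h hm)
            rw [combine_of_ne hk hW _ hn, this]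
            omega
      · rw [combine_of_ne hk hY f (n := m) hp, combine_of_ne hk hW _ hn]
        omega
    · push Not at hm
      rw [combine_of_forall_eq f hm, combine_of_forall_eq]
      · omega
      · intro m
        rw [combine_of_ne hk hW _ hn, hm]
        omega
  · push Not at h
    rw [combine_of_forall_eq _ h, combine_of_forall_eq]
    exact fun m => combine_of_forall_eq _ h

theorem blockLE_iff (hk : 1 ≤ k) {W Y : ℕ → ℕ → ℕ} (hW : IsBlockSeq k W) :
    BlockLE k Y W ↔ ∃ Z, IsBlockSeq k Z ∧ Y = fun n => combine k W (Z n) := by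
  constructor
  · rintro ⟨hY, h⟩
    choose Z hZ hYZ using fun n => (inSubspace_iff hk hW).1 (h n)
    refine ⟨Z, ⟨hZ, fun n => vecLt_of_combine hk hW (hZ n) (hZ _) ?_⟩, funext hYZ⟩
    rw [← hYZ, ← hYZ]
    exact hY.2 n
  · rintro ⟨Z, hZ, rfl⟩
    exact ⟨isBlockSeq_combine hk hW hZ, fun n => (inSubspace_iff hk hW).2 ⟨_, hZ.1 n, rfl⟩⟩

theorem BlockLE.inSubspace (hk : 1 ≤ k) {W Y : ℕ → ℕ → ℕ} (hW : IsBlockSeq k W)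
    (h : BlockLE k Y W) {w : ℕ → ℕ} (hw : InSubspace k Y w) : InSubspace k W w := by
  obtain ⟨f, hf, rfl⟩ := (inSubspace_iff hk h.1).1 hw
  obtain ⟨Z, hZ, rfl⟩ := (blockLE_iff hk hW).1 h
  exact (inSubspace_iff hk hW).2 ⟨_, isFin_combine hk hZ hf, combine_combine hk hW hZ hf⟩

theorem BlockLE.trans (hk : 1 ≤ k) {W Y Z : ℕ → ℕ → ℕ} (hW : IsBlockSeq k W)
    (h₁ : BlockLE k Z Y) (h₂ : BlockLE k Y W) : BlockLE k Z W :=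
  ⟨h₁.1, fun n => BlockLE.inSubspace hk hW h₂ (h₁.2 n)⟩

theorem inSubspace_self (W : ℕ → ℕ → ℕ) (n : ℕ) : InSubspace k W (W n) :=
  ⟨{n}, fun _ => 0, Set.subset_univ _, ⟨n, by simp⟩, by simp, ⟨n, by simp⟩, by
    funext p; simp [Tmap]⟩

theorem BlockLE.refl {W : ℕ → ℕ → ℕ} (hW : IsBlockSeq k W) : BlockLE k W W :=
  ⟨hW, inSubspace_self W⟩

/-- The sequence `W` with its first `n` terms removed. -/
def shift (n : ℕ) (W : ℕ → ℕ → ℕ) : ℕ → ℕ → ℕ := fun i => W (i + n)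

theorem isBlockSeq_shift {W : ℕ → ℕ → ℕ} (hW : IsBlockSeq k W) (n : ℕ) :
    IsBlockSeq k (shift n W) :=
  ⟨fun i => hW.1 _, fun i => by
    have := hW.2 (i + n)
    rwa [add_right_comm] at this⟩

theorem shift_shift (m n : ℕ) (W : ℕ → ℕ → ℕ) : shift m (shift n W) = shift (m + n) W := by
  funext i
  simp [shift, add_assoc]

theorem shift_zero (W : ℕ → ℕ → ℕ) : shift 0 W = W := rfl

theorem blockLE_shift {W : ℕ → ℕ → ℕ} (hW : IsBlockSeq k W) (n : ℕ) :
    BlockLE k (shift n W) W :=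
  ⟨isBlockSeq_shift hW n, fun _ => inSubspace_self W _⟩

theorem inSubspace_shift (hk : 1 ≤ k) {W : ℕ → ℕ → ℕ} (hW : IsBlockSeq k W) {m : ℕ} {f : ℕ → ℕ}
    (hf : IsFin k f) (hm : ∀ n, f n ≠ 0 → m ≤ n) :
    InSubspace k (shift m W) (combine k W f) := by
  have hS := isBlockSeq_shift hW m
  refine (inSubspace_iff hk hS).2 ⟨fun i => f (i + m), ⟨fun n => hf.1 _, ?_, ?_⟩, ?_⟩
  · exact hf.2.1.preimage (add_left_injective m).injOn
  · obtain ⟨n, hn⟩ := hf.2.2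
    refine ⟨n - m, ?_⟩
    dsimp only
    rw [Nat.sub_add_cancel (hm n (by omega)), hn]
  · funext p
    by_cases h : ∃ n, W n p ≠ 0
    · obtain ⟨n, hn⟩ := h
      rw [combine_of_ne hk hW f hn]
      by_cases hnm : m ≤ n
      · obtain ⟨i, rfl⟩ := Nat.exists_eq_add_of_le' hnm
        rw [combine_of_ne hk hS _ (n := i) hn]
        rfl
      · have h0 : f n = 0 := by
          by_contra h
          exact hnm (hm n h)
        have := (hW.1 n).1 p
        rw [combine_of_forall_eq]
        · omega
        · intro i
          by_contra h
          have := IsBlockSeq.index_unique hk hW hn (n := i + m) h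
          omega
    · push Not at h
      rw [combine_of_forall_eq _ h, combine_of_forall_eq]
      exact fun i => h _

/-- A block subsequence splits after its first `j` terms along a splitting of the
ambient sequence. -/
theorem BlockLE.exists_split (hk : 1 ≤ k) {W Y : ℕ → ℕ → ℕ} (hW : IsBlockSeq k W)
    (h : BlockLE k Y W) (j : ℕ) : ∃ m, j ≤ m ∧ (∀ i < j, InSubspaceOn k W (Set.Iio m) (Y i)) ∧
      BlockLE k (shift j Y) (shift m W) := by
  obtain ⟨Z, hZ, rfl⟩ := (blockLE_iff hk hW).1 h
  cases j with
  | zero => exact ⟨0, le_rfl, by simp, h⟩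
  | succ j =>
    have hne : (hZ.1 j).2.1.toFinset.Nonempty := by
      obtain ⟨p, -, hp⟩ := IsFin.exists_peak hk (hZ.1 j)
      exact ⟨p, by simpa using hp⟩
    set q := (hZ.1 j).2.1.toFinset.max' hne with hq
    have hqZ : Z j q ≠ 0 := by
      have := Finset.max'_mem _ hne
      rw [← hq] at this
      simpa using this
    have hmax : ∀ n, Z j n ≠ 0 → n ≤ q := fun n hn => Finset.le_max' _ _ (by simpa using hn)
    refine ⟨q + 1, Nat.succ_le_succ (IsBlockSeq.index_le hk hZ hqZ), fun i hi => ?_,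
      isBlockSeq_shift h.1 _, fun i => ?_⟩
    · refine (inSubspaceOn_iff hk hW).2 ⟨_, hZ.1 i, fun n hn => ?_, rfl⟩
      rw [Set.mem_Iio, Nat.lt_succ_iff]
      rcases Nat.lt_succ_iff_lt_or_eq.1 hi with hi | rfl
      · exact (IsBlockSeq.vecLt hk hZ hi n q hn hqZ).le
      · exact hmax n hn
    · exact inSubspace_shift hk hW (hZ.1 _) fun n hn =>
        IsBlockSeq.vecLt hk hZ (by omega : j < i + (j + 1)) q n hqZ hn

theorem BlockLE.shift_le (hk : 1 ≤ k) {W Y : ℕ → ℕ → ℕ} (hW : IsBlockSeq k W)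
    (h : BlockLE k Y W) (j : ℕ) : BlockLE k (shift j Y) (shift j W) := by
  obtain ⟨m, hm, -, h⟩ := BlockLE.exists_split hk hW h j
  obtain ⟨d, rfl⟩ := Nat.exists_eq_add_of_le' hm
  rw [← shift_shift] at h
  exact BlockLE.trans hk (isBlockSeq_shift hW j) h (blockLE_shift (isBlockSeq_shift hW j) d)

/-- The sequence `s⌢Y`. -/
def cat (s : List (ℕ → ℕ)) (Y : ℕ → ℕ → ℕ) : ℕ → ℕ → ℕ := fun n =>
  if h : n < s.length then s[n] else Y (n - s.length)

theorem cat_of_lt {s : List (ℕ → ℕ)} (Y : ℕ → ℕ → ℕ) {n : ℕ} (h : n < s.length) :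
    cat s Y n = s[n] := dif_pos h

theorem cat_of_le {s : List (ℕ → ℕ)} (Y : ℕ → ℕ → ℕ) {n : ℕ} (h : s.length ≤ n) :
    cat s Y n = Y (n - s.length) := dif_neg (by omega)

@[simp] theorem length_restrictN (Y : ℕ → ℕ → ℕ) (n : ℕ) : (restrictN Y n).length = n := by
  simp [restrictN]

theorem cat_append (s t : List (ℕ → ℕ)) (Y : ℕ → ℕ → ℕ) : cat (s ++ t) Y = cat s (cat t Y) := by
  funext n
  by_cases h : n < s.length
  · rw [cat_of_lt _ h, cat_of_lt _ (by simp; omega), List.getElem_append_left h]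
  · rw [cat_of_le (s := s) _ (by omega)]
    by_cases h' : n < s.length + t.length
    · rw [cat_of_lt _ (by simp; omega), cat_of_lt _ (by omega),
        List.getElem_append_right (by omega)]
    · rw [cat_of_le _ (by simp; omega), cat_of_le _ (by omega)]
      simp only [List.length_append]
      congr 1
      omega

theorem shift_cat (s : List (ℕ → ℕ)) (Y : ℕ → ℕ → ℕ) : shift s.length (cat s Y) = Y := by
  funext n
  simp [shift, cat_of_le]

theorem shift_add_cat (s : List (ℕ → ℕ)) (Y : ℕ → ℕ → ℕ) (j : ℕ) :
    shift (j + s.length) (cat s Y) = shift j Y := by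
  rw [← shift_shift, shift_cat]

theorem restrictN_cat (s : List (ℕ → ℕ)) (Y : ℕ → ℕ → ℕ) : restrictN (cat s Y) s.length = s := by
  apply List.ext_getElem
  · simp
  · intro n h h'
    simp [restrictN, cat_of_lt _ h']

theorem cat_restrictN (Y : ℕ → ℕ → ℕ) (n : ℕ) : cat (restrictN Y n) (shift n Y) = Y := by
  funext i
  by_cases h : i < n
  · rw [cat_of_lt _ (by simpa using h)]
    simp [restrictN]
  · rw [cat_of_le _ (by simp; omega)]
    simp only [shift, length_restrictN]
    congr 1
    omega

theorem cat_restrictN_of_lt (X V : ℕ → ℕ → ℕ) {n i : ℕ} (h : i < n) :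
    cat (restrictN X n) V i = X i := by
  rw [cat_of_lt _ (by simpa using h)]
  simp [restrictN]

theorem restrictN_add_cat (s : List (ℕ → ℕ)) (Y : ℕ → ℕ → ℕ) (j : ℕ) :
    restrictN (cat s Y) (j + s.length) = s ++ restrictN Y j := by
  have := restrictN_cat (s ++ restrictN Y j) (shift j Y)
  rwa [cat_append, cat_restrictN, List.length_append, length_restrictN, add_comm] at this

theorem restrictN_cat_restrictN {n m : ℕ} (h : n ≤ m) (Y V : ℕ → ℕ → ℕ) :
    restrictN (cat (restrictN Y m) V) n = restrictN Y n := by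
  apply List.ext_getElem
  · simp
  · intro i hi hi'
    simp only [length_restrictN] at hi
    simp [restrictN]
    have := cat_restrictN_of_lt Y V (hi.trans_le h)
    simpa [restrictN] using this

theorem BlockLE.cat_le (hk : 1 ≤ k) {X V : ℕ → ℕ → ℕ} (hX : IsBlockSeq k X) {n : ℕ}
    (h : BlockLE k V (shift n X)) : BlockLE k (cat (restrictN X n) V) X := by
  refine ⟨⟨fun i => ?_, fun i => ?_⟩, fun i => ?_⟩
  · by_cases hi : i < n
    · rw [cat_restrictN_of_lt _ _ hi]; exact hX.1 i
    · rw [cat_of_le _ (by simp; omega)]; exact h.1.1 _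
  · rcases lt_trichotomy (i + 1) n with hi | hi | hi
    · rw [cat_restrictN_of_lt _ _ hi, cat_restrictN_of_lt _ _ (by omega)]; exact hX.2 i
    · rw [cat_restrictN_of_lt _ _ (by omega : i < n), cat_of_le _ (by simp; omega)]
      intro p q hp hq
      obtain ⟨f, hf, hV⟩ := (inSubspace_iff hk (isBlockSeq_shift hX n)).1
        (h.2 (i + 1 - (restrictN X n).length))
      rw [hV] at hq
      obtain ⟨m, -, hm⟩ := combine_ne_zero hk (isBlockSeq_shift hX n) hq
      exact IsBlockSeq.vecLt hk hX (by omega : i < m + n) p q hp hm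
    · rw [cat_of_le _ (by simp; omega), cat_of_le _ (by simp; omega),
        Nat.sub_add_comm (by simp; omega)]
      exact h.1.2 _
  · by_cases hi : i < n
    · rw [cat_restrictN_of_lt _ _ hi]; exact inSubspace_self X i
    · rw [cat_of_le _ (by simp; omega)]
      exact BlockLE.inSubspace hk hX (blockLE_shift hX n) (h.2 _)

/-- Vectors with pointwise maximum as multiplication. -/
def SupVec : Type := ℕ → ℕ

instance : Semigroup SupVec where
  mul x y := fun n => max (x n) (y n)
  mul_assoc x y z := funext fun n => max_assoc (x n) (y n) (z n)

/-- The zero vector. -/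
def SupVec.zero : SupVec := fun _ => 0

theorem SupVec.mul_apply (x y : SupVec) (n : ℕ) : (x * y) n = max (x n) (y n) := rfl

attribute [local instance] Ultrafilter.mul Ultrafilter.semigroup

/-- The map `T^i` on vectors. -/
def supT (i : ℕ) (x : SupVec) : SupVec := Tmap i x

theorem supT_mul (i : ℕ) (x y : SupVec) : supT i (x * y) = supT i x * supT i y := by
  funext n
  have h : ∀ a b : ℕ, max a b - i = max (a - i) (b - i) := by intros; omega
  exact h _ _

theorem supT_supT (i j : ℕ) (x : SupVec) : supT i (supT j x) = supT (j + i) x :=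
  funext fun n => Nat.sub_sub (x n) j i

theorem map_supT_mul (i : ℕ) (U V : Ultrafilter SupVec) :
    (U * V).map (supT i) = U.map (supT i) * V.map (supT i) := by
  refine Ultrafilter.coe_inj.mp <| Filter.ext' fun p => ?_
  rw [Ultrafilter.eventually_mul]
  simp only [Ultrafilter.coe_map, Filter.eventually_map, Ultrafilter.eventually_mul, supT_mul]

theorem map_supT_map (i j : ℕ) (U : Ultrafilter SupVec) :
    (U.map (supT j)).map (supT i) = U.map (supT (j + i)) := by
  rw [Ultrafilter.map_map]
  congr 1
  funext x
  exact supT_supT i j x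

/-- Ultrafilters concentrating on `j`-vectors with arbitrarily late support. -/
def IsCofinal (j : ℕ) (U : Ultrafilter SupVec) : Prop :=
  ∀ b, ∀ᶠ x : SupVec in (U : Filter SupVec), IsFin j x ∧ ∀ p, x p ≠ 0 → b ≤ p

theorem isFin_max {i j : ℕ} {x y : ℕ → ℕ} (hx : IsFin i x) (hy : IsFin j y) :
    IsFin (max i j) (fun n => max (x n) (y n)) := by
  refine ⟨fun n => max_le_max (hx.1 n) (hy.1 n), (hx.2.1.union hy.2.1).subset fun n hn => ?_, ?_⟩
  · by_contra h
    simp only [Set.mem_union, Set.mem_ofPred_eq, not_or, not_not] at h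
    simp [h.1, h.2] at hn
  · rcases le_total i j with h | h
    · obtain ⟨n, hn⟩ := hy.2.2
      have := hx.1 n
      exact ⟨n, by rw [max_eq_right h]; exact hn ▸ max_eq_right (by omega)⟩
    · obtain ⟨n, hn⟩ := hx.2.2
      have := hy.1 n
      exact ⟨n, by rw [max_eq_left h]; exact hn ▸ max_eq_left (by omega)⟩

theorem IsCofinal.mul {i j : ℕ} {U V : Ultrafilter SupVec} (hU : IsCofinal i U)
    (hV : IsCofinal j V) : IsCofinal (max i j) (U * V) := by
  intro b
  rw [Ultrafilter.eventually_mul]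
  filter_upwards [hU b] with x hx
  filter_upwards [hV b] with y hy
  refine ⟨isFin_max hx.1 hy.1, fun p hp => ?_⟩
  by_cases h : x p = 0
  · by_cases h' : y p = 0
    · simp [SupVec.mul_apply, h, h'] at hp
    · exact hy.2 p h'
  · exact hx.2 p h

theorem isClosed_isCofinal (j : ℕ) : IsClosed {U | IsCofinal j U} := by
  simp only [IsCofinal, Set.ofPred_forall]
  exact isClosed_iInter fun b => ultrafilter_isClosed_basic _

theorem isClosed_map_eq (f : SupVec → SupVec) (V : Ultrafilter SupVec) :
    IsClosed {U : Ultrafilter SupVec | U.map f = V} := by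
  have : {U : Ultrafilter SupVec | U.map f = V} = ⋂ s ∈ V, {U | f ⁻¹' s ∈ U} := by
    ext U
    simp only [Set.mem_ofPred_eq, Set.mem_iInter]
    constructor
    · rintro rfl s hs
      exact hs
    · intro h
      exact Ultrafilter.eq_of_le fun s hs => h s hs
  rw [this]
  exact isClosed_biInter fun s _ => ultrafilter_isClosed_basic _

theorem exists_isCofinal_map_eq {j : ℕ} {U : Ultrafilter SupVec} (hU : IsCofinal j U) :
    ∃ V, IsCofinal (j + 1) V ∧ V.map (supT 1) = U := by
  rcases Nat.eq_zero_or_pos j with rfl | hj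
  · let e : ℕ → SupVec := fun n p => if p = n then 1 else 0
    refine ⟨(Filter.hyperfilter ℕ).map e, fun b => ?_, ?_⟩
    · rw [Ultrafilter.coe_map, Filter.eventually_map]
      have : ∀ᶠ n in (Filter.hyperfilter ℕ : Filter ℕ), b ≤ n :=
        Nat.hyperfilter_le_atTop (Filter.eventually_ge_atTop b)
      filter_upwards [this] with n hn
      refine ⟨⟨fun p => ?_, (Set.finite_singleton n).subset fun p hp => ?_, n, ?_⟩, fun p hp => ?_⟩
      · by_cases h : p = n <;> simp [e, h]
      · by_contra h
        exact hp (if_neg h)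
      · simp [e]
      · have : p = n := by
          by_contra h
          exact hp (if_neg h)
        omega
    · refine Ultrafilter.eq_of_le fun s hs => ?_
      have hz : SupVec.zero ∈ s := by
        obtain ⟨x, hx, hx'⟩ := Ultrafilter.nonempty_of_mem (Filter.inter_mem hs (hU 0))
        exact Set.mem_of_eq_of_mem (funext fun p => (Nat.le_zero.1 (hx'.1.1 p)).symm) hx
      rw [Ultrafilter.map_map]
      refine Filter.mem_map.2 (Filter.univ_mem' fun n => ?_)
      change supT 1 (e n) ∈ s
      refine Set.mem_of_eq_of_mem (funext fun p => ?_) hz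
      by_cases h : p = n <;> simp [e, supT, Tmap, SupVec.zero, h]
  · let σ : SupVec → SupVec := fun x p => if x p = 0 then 0 else x p + 1
    refine ⟨U.map σ, fun b => ?_, ?_⟩
    · rw [Ultrafilter.coe_map, Filter.eventually_map]
      filter_upwards [hU b] with x hx
      have hσ : ∀ p, σ x p ≠ 0 → x p ≠ 0 := fun p hp h => hp (if_pos h)
      refine ⟨⟨fun p => ?_, hx.1.2.1.subset hσ, ?_⟩, fun p hp => hx.2 p (hσ p hp)⟩
      · have := hx.1.1 p
        simp only [σ]
        split_ifs <;> omega
      · obtain ⟨p, hp⟩ := hx.1.2.2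
        exact ⟨p, by simp only [σ]; split_ifs <;> omega⟩
    · rw [Ultrafilter.map_map]
      have h : supT 1 ∘ σ = id := funext fun x => funext fun p => ?_
      · rw [h, Ultrafilter.map_id]
      simp only [supT, Tmap, σ, Function.comp, id]
      split_ifs <;> omega

/-- The properties carried along the inductive construction of Gowers' ultrafilters. -/
def IsGowers (j : ℕ) (U : Ultrafilter SupVec) : Prop :=
  IsCofinal j U ∧ U * U = U ∧ U * U.map (supT 1) = U ∧ U.map (supT 1) * U = U

theorem isGowers_zero : IsGowers 0 (pure SupVec.zero) := by
  have hT : (pure SupVec.zero : Ultrafilter SupVec).map (supT 1) =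
      pure SupVec.zero := by
    rw [Ultrafilter.map_pure]
    congr 1
  have hm : (pure SupVec.zero : Ultrafilter SupVec) * pure SupVec.zero =
      pure SupVec.zero := by
    refine Ultrafilter.coe_inj.mp <| Filter.ext' fun p => ?_
    rw [Ultrafilter.eventually_mul]
    exact Iff.rfl
  refine ⟨fun b => ?_, hm, by rw [hT, hm], by rw [hT, hm]⟩
  exact Filter.eventually_pure.2 ⟨⟨fun _ => le_rfl, by simp [SupVec.zero], 0, rfl⟩, fun p hp => absurd rfl hp⟩

theorem IsGowers.exists_succ {j : ℕ} {U : Ultrafilter SupVec} (hU : IsGowers j U) :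
    ∃ V, IsGowers (j + 1) V ∧ V.map (supT 1) = U := by
  obtain ⟨hc, hUU, hUT, hTU⟩ := hU
  let S : Set (Ultrafilter SupVec) := {X | IsCofinal (j + 1) X} ∩ {X | X.map (supT 1) = U}
  have hS : IsClosed S := (isClosed_isCofinal _).inter (isClosed_map_eq _ _)
  have hmax : max (j + 1) j = j + 1 := by omega
  have hmax' : max j (j + 1) = j + 1 := by omega
  obtain ⟨E, ⟨X, hX, rfl⟩, hE⟩ := exists_idempotent_in_compact_subsemigroup
    Ultrafilter.continuous_mul_left ((· * U) '' S)
    ((show S.Nonempty from exists_isCofinal_map_eq hc).image (· * U))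
    (hS.isCompact.image (Ultrafilter.continuous_mul_left U)) (by
      rintro _ ⟨X, hX, rfl⟩ _ ⟨Y, hY, rfl⟩
      refine ⟨X * U * Y, ⟨?_, ?_⟩, by simp only [mul_assoc]⟩
      · have := (hX.1.mul hc).mul hY.1
        simpa [hmax] using this
      · change (X * U * Y).map (supT 1) = U
        rw [map_supT_mul, map_supT_mul, hX.2, hY.2, hUT, hUU])
  dsimp only at hE
  have hEU : X * U * U = X * U := by rw [mul_assoc, hUU]
  have hT : (U * (X * U)).map (supT 1) = U := by
    rw [map_supT_mul, map_supT_mul, hX.2, hUT, hTU]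
  refine ⟨U * (X * U), ⟨?_, ?_, ?_, ?_⟩, hT⟩
  · have := hc.mul (hX.1.mul hc)
    rwa [hmax, hmax'] at this
  · calc U * (X * U) * (U * (X * U)) = U * ((X * U * U) * (X * U)) := by simp only [mul_assoc]
      _ = U * (X * U) := by rw [hEU, hE]
  · rw [hT, mul_assoc, hEU]
  · rw [hT, ← mul_assoc, hUU]

theorem exists_gowers_ultrafilters : ∃ U : ℕ → Ultrafilter SupVec,
    (∀ j, IsCofinal j (U j)) ∧ U 0 = pure SupVec.zero ∧
    (∀ i j, U i * U j = U (max i j)) ∧ ∀ i d, (U (i + d)).map (supT d) = U i := by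
  choose! next hnext hnext' using fun j U => @IsGowers.exists_succ j U
  let U : ℕ → Ultrafilter SupVec := fun j => Nat.rec (pure SupVec.zero) next j
  have hU : ∀ j, IsGowers j (U j) := fun j => by
    induction j with
    | zero => exact isGowers_zero
    | succ j ih => exact hnext j _ ih
  have hT : ∀ j, (U (j + 1)).map (supT 1) = U j := fun j => hnext' j _ (hU j)
  have hr : ∀ j d, U (j + d) * U j = U (j + d) := by
    intro j d
    induction d with
    | zero => exact (hU j).2.1
    | succ d ih =>
      have h := (hU (j + d + 1)).2.2.1
      rw [hT] at h
      rw [← add_assoc, ← h, mul_assoc, ih]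
  have hl : ∀ j d, U j * U (j + d) = U (j + d) := by
    intro j d
    induction d with
    | zero => exact (hU j).2.1
    | succ d ih =>
      have h := (hU (j + d + 1)).2.2.2
      rw [hT] at h
      rw [← add_assoc, ← h, ← mul_assoc, ih]
  refine ⟨U, fun j => (hU j).1, rfl, fun i j => ?_, fun i d => ?_⟩
  · rcases le_total i j with h | h <;> obtain ⟨d, rfl⟩ := Nat.exists_eq_add_of_le h
    · rw [hl, max_eq_right h]
    · rw [hr, max_eq_left h]
  · induction d with
    | zero =>
      exact Ultrafilter.map_id (U i)
    | succ d ih =>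
      rw [add_comm d 1, ← map_supT_map, add_comm 1 d, ← add_assoc, hT (i + d), ih]

/-- Gowers' theorem for `FIN_k`. -/
theorem exists_combine_mem (hk : 1 ≤ k) (C : Set (ℕ → ℕ)) :
    ∃ Z, IsBlockSeq k Z ∧ ((∀ f, IsFin k f → combine k Z f ∈ C) ∨
      ∀ f, IsFin k f → combine k Z f ∉ C) := by
  obtain ⟨U, hU, hU0, hmul, hT⟩ := exists_gowers_ultrafilters
  suffices H : ∀ D : Set SupVec, D ∈ U k →
      ∃ Z, IsBlockSeq k Z ∧ ∀ f, IsFin k f → combine k Z f ∈ D by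
    rcases Ultrafilter.mem_or_compl_mem (U k) C with h | h
    · exact (H _ h).imp fun Z hZ => ⟨hZ.1, Or.inl hZ.2⟩
    · exact (H _ h).imp fun Z hZ => ⟨hZ.1, Or.inr hZ.2⟩
  intro D hD
  have step : ∀ A : {A : ℕ → Set SupVec // ∀ j ≤ k, A j ∈ U j}, ∃ x : SupVec, IsFin k x ∧
      x ∈ A.1 k ∧ ∃ B : {A : ℕ → Set SupVec // ∀ j ≤ k, A j ∈ U j}, ∀ j ≤ k, ∀ y ∈ B.1 j,
        y ∈ A.1 j ∧ VecLt x y ∧ ∀ i ≤ k, supT (k - i) x * y ∈ A.1 (max i j) := by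
    rintro ⟨A, hA⟩
    have h₁ : ∀ᶠ x in (U k : Filter SupVec), ∀ j ∈ Set.Iic k, ∀ i ∈ Set.Iic k,
        ∀ᶠ y in (U j : Filter SupVec), supT (k - i) x * y ∈ A (max i j) := by
      rw [Filter.eventually_all_finite (Set.finite_Iic k)]
      intro j hj
      rw [Filter.eventually_all_finite (Set.finite_Iic k)]
      intro i hi
      have := hA (max i j) (max_le hi hj)
      rw [← hmul] at this
      have := (Ultrafilter.eventually_mul _ _ _).1 this
      have hi' := hT i (k - i)
      rw [Nat.add_sub_cancel' hi] at hi'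
      rw [← hi', Ultrafilter.coe_map, Filter.eventually_map] at this
      exact this
    obtain ⟨x, hx, hxk, hxA⟩ := (h₁.and ((hU k 0).and (hA k le_rfl))).exists
    refine ⟨x, hxk.1, hxA, ⟨fun j => {y | y ∈ A j ∧ VecLt x y ∧
      ∀ i ≤ k, supT (k - i) x * y ∈ A (max i j)}, fun j hj => ?_⟩, fun j _ y hy => hy⟩
    refine Filter.inter_mem (hA j hj) (Filter.inter_mem ?_ ?_)
    · obtain ⟨b, hb⟩ := hxk.1.2.1.bddAbove
      filter_upwards [hU j (b + 1)] with y hy p q hp hq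
      exact (Nat.lt_succ_of_le (hb hp)).trans_le (hy.2 q hq)
    · exact (Filter.eventually_all_finite (Set.finite_Iic k)).2 (hx j hj)
  choose x hxk hxA next hnext using step
  let A : ℕ → {A : ℕ → Set SupVec // ∀ j ≤ k, A j ∈ U j} := fun n =>
    Nat.rec ⟨fun j => if j = k then D else Set.univ, fun j _ => by
      by_cases h : j = k
      · simpa [h] using hD
      · simp only [if_neg h]
        exact Filter.univ_mem⟩ (fun _ => next) n
  let Z : ℕ → ℕ → ℕ := fun n => x (A n)
  have hZ : IsBlockSeq k Z := ⟨fun n => hxk _, fun n =>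
    (hnext (A n) k le_rfl _ (hxA (A (n + 1)))).2.1⟩
  have key : ∀ d n j f, j ≤ k → IsFin j f → (∀ p, f p ≠ 0 → n ≤ p ∧ p < n + d) →
      combine k Z f ∈ (A n).1 j := by
    intro d
    induction d with
    | zero =>
      intro n j f hj hf hs
      have hf0 : ∀ p, f p = 0 := fun p => by
        by_contra h
        have := hs p h
        omega
      obtain ⟨p, hp⟩ := hf.2.2
      obtain rfl : j = 0 := by rw [← hp, hf0]
      have h0 := (A n).2 0 hj
      rw [hU0] at h0
      have h0 : SupVec.zero ∈ (A n).1 0 := h0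
      refine Set.mem_of_eq_of_mem (funext fun p => ?_) h0
      by_contra h
      obtain ⟨m, hm, -⟩ := combine_ne_zero hk hZ h
      exact hm (hf0 m)
    | succ d ih =>
      intro n j f hj hf hs
      let g : ℕ → ℕ := fun p => if p = n then 0 else f p
      have hgf : ∀ p, g p ≠ 0 → p ≠ n ∧ f p ≠ 0 := fun p hp => by
        by_cases h : p = n
        · exact absurd (if_pos h) hp
        · exact ⟨h, by simpa [g, h] using hp⟩
      have hgle : ∀ p, g p ≤ f p := fun p => by
        simp only [g]
        split_ifs <;> omega
      obtain ⟨i, hij, hg⟩ : ∃ i, j = max (f n) i ∧ IsFin i g := by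
        by_cases hgz : ∀ p, g p = 0
        · refine ⟨0, ?_, fun p => (hgz p).le, by simp [hgz], 0, hgz 0⟩
          obtain ⟨p, hp⟩ := hf.2.2
          have := hf.1 n
          by_cases h : p = n
          · subst h; omega
          · have := hgz p
            simp only [g, if_neg h] at this
            omega
        · push Not at hgz
          have hfin : (Set.range g).Finite := by
            refine (Set.finite_Iic j).subset ?_
            rintro _ ⟨p, rfl⟩
            exact (hgle p).trans (hf.1 p)
          obtain ⟨_, ⟨q, rfl⟩, hq⟩ := Set.exists_max_image _ id hfin (Set.range_nonempty g)
          have hq : ∀ p, g p ≤ g q := fun p => hq _ ⟨p, rfl⟩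
          refine ⟨g q, ?_, hq, hf.2.1.subset fun p hp => (hgf p hp).2, q, rfl⟩
          obtain ⟨p, hp⟩ := hf.2.2
          have := hf.1 n
          have := (hgle q).trans (hf.1 q)
          by_cases h : p = n
          · subst h; omega
          · have hgp : g p = f p := if_neg h
            have := hq p
            omega
      have hfn : f n ≤ k := (hf.1 n).trans hj
      have hik : i ≤ k := by omega
      have hgA := ih (n + 1) i g hik hg fun p hp => by
        obtain ⟨h, h'⟩ := hgf p hp
        have := hs p h'
        omega
      have := (hnext (A n) i hik _ hgA).2.2 (f n) hfn
      rw [← hij] at this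
      refine Set.mem_of_eq_of_mem (funext fun p => ?_) this
      change _ = max (Z n p - (k - f n)) (combine k Z g p)
      by_cases h : ∃ m, Z m p ≠ 0
      · obtain ⟨m, hm⟩ := h
        rw [combine_of_ne hk hZ _ hm, combine_of_ne hk hZ _ hm]
        by_cases hmn : m = n
        · subst hmn
          have := (hZ.1 m).1 p
          simp only [g, if_pos rfl]
          omega
        · have : Z n p = 0 := by
            by_contra h
            exact hmn (IsBlockSeq.index_unique hk hZ hm h)
          simp [g, hmn, this]
      · push Not at h
        rw [combine_of_forall_eq _ h, combine_of_forall_eq _ h, h]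
        simp
  refine ⟨Z, hZ, fun f hf => ?_⟩
  obtain ⟨b, hb⟩ := hf.2.1.bddAbove
  have := key (b + 1) 0 k f le_rfl hf fun p hp => by
    have := hb hp
    omega
  simpa [A] using this

/-- Gowers' theorem inside a combinatorial subspace. -/
theorem exists_homogeneous_subspace (hk : 1 ≤ k) {W : ℕ → ℕ → ℕ} (hW : IsBlockSeq k W)
    (C : Set (ℕ → ℕ)) :
    ∃ Z, BlockLE k Z W ∧ ((∀ w, InSubspace k Z w → w ∈ C) ∨ ∀ w, InSubspace k Z w → w ∉ C) := by
  obtain ⟨Z, hZ, h⟩ := exists_combine_mem hk (combine k W ⁻¹' C)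
  have hZW := isBlockSeq_combine hk hW hZ
  refine ⟨_, (blockLE_iff hk hW).2 ⟨Z, hZ, rfl⟩, h.imp (fun h w hw => ?_) fun h w hw => ?_⟩ <;>
  · obtain ⟨f, hf, rfl⟩ := (inSubspace_iff hk hZW).1 hw
    rw [combine_combine hk hW hZ hf]
    exact h f hf

theorem shift_cat_restrictN {n m : ℕ} (h : n ≤ m) (Y V : ℕ → ℕ → ℕ) :
    shift n (cat (restrictN Y m) V) = cat (restrictN (shift n Y) (m - n)) V := by
  funext i
  change cat (restrictN Y m) V (i + n) = _
  by_cases hi : i < m - n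
  · rw [cat_restrictN_of_lt _ _ hi, cat_restrictN_of_lt _ _ (by omega)]
    rfl
  · rw [cat_of_le _ (by simp; omega), cat_of_le _ (by simp; omega)]
    congr 1
    simp
    omega

/-! ### Dense hereditary properties and fusion -/

/-- A property of block sequences which is inherited by block subsequences and which every block
sequence has after thinning it out. -/
structure DenseHereditary (k : ℕ) (P : (ℕ → ℕ → ℕ) → Prop) : Prop where
  mono : ∀ W Z, IsBlockSeq k W → BlockLE k Z W → P W → P Z
  exists_le : ∀ W, IsBlockSeq k W → ∃ Z, BlockLE k Z W ∧ P Z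

theorem DenseHereditary.forall_mem (hk : 1 ≤ k) {ι : Type*} {P : ι → (ℕ → ℕ → ℕ) → Prop}
    (hP : ∀ i, DenseHereditary k (P i)) {F : Set ι} (hF : F.Finite) :
    DenseHereditary k fun Z => ∀ i ∈ F, P i Z := by
  refine ⟨fun W Z hW h H i hi => (hP i).mono W Z hW h (H i hi), ?_⟩
  induction F, hF using Set.Finite.induction_on with
  | empty => exact fun W hW => ⟨W, BlockLE.refl hW, by simp⟩
  | @insert i F _ _ ih =>
    intro W hW
    obtain ⟨Z, hZ, h⟩ := ih W hW
    obtain ⟨V, hV, h'⟩ := (hP i).exists_le Z hZ.1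
    refine ⟨V, BlockLE.trans hk hW hV hZ, ?_⟩
    rintro j (rfl | hj)
    · exact h'
    · exact (hP j).mono Z V hZ.1 hV (h j hj)

theorem finite_inSubspaceOn_Iio (hk : 1 ≤ k) {W : ℕ → ℕ → ℕ} (hW : IsBlockSeq k W) (n : ℕ) :
    {w | InSubspaceOn k W (Set.Iio n) w}.Finite := by
  refine (Set.finite_range fun φ : Fin n → Fin (k + 1) =>
    combine k W fun i => if h : i < n then (φ ⟨i, h⟩ : ℕ) else 0).subset ?_
  intro w hw
  obtain ⟨f, hf, hn, rfl⟩ := (inSubspaceOn_iff hk hW).1 hw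
  refine ⟨fun i => ⟨f i, Nat.lt_succ_of_le (hf.1 i)⟩, ?_⟩
  dsimp only
  congr 1
  funext i
  split_ifs with h
  · rfl
  · by_contra h'
    exact h (hn i (Ne.symm h'))

theorem finite_lists {S : Set (ℕ → ℕ)} (hS : S.Finite) (n : ℕ) :
    {t : List (ℕ → ℕ) | t.length ≤ n ∧ ∀ w ∈ t, w ∈ S}.Finite := by
  have := hS.to_subtype
  refine ((List.finite_length_le S n).image (List.map Subtype.val)).subset ?_
  rintro t ⟨ht, hS⟩
  exact ⟨t.attach.map fun w => ⟨w.1, hS w.1 w.2⟩, by simpa using ht, by simp [Function.comp_def]⟩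

theorem inSubspaceOn_congr {W Z : ℕ → ℕ → ℕ} {I : Set ℕ} (h : ∀ i ∈ I, W i = Z i) {w : ℕ → ℕ}
    (hw : InSubspaceOn k W I w) : InSubspaceOn k Z I w := by
  obtain ⟨s, e, hs, hne, hle, h0, rfl⟩ := hw
  refine ⟨s, e, hs, hne, hle, h0, funext fun p => Finset.sum_congr rfl fun i hi => ?_⟩
  rw [h i (hs hi)]

theorem exists_fusion_step (hk : 1 ≤ k) {P : List (ℕ → ℕ) → (ℕ → ℕ → ℕ) → Prop}
    (hP : ∀ s, DenseHereditary k (P s)) (a : List (ℕ → ℕ)) {X : ℕ → ℕ → ℕ}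
    (hX : IsBlockSeq k X) (n : ℕ) : ∃ X', BlockLE k X' X ∧ (∀ i < n, X' i = X i) ∧
      ∀ t : List (ℕ → ℕ), t.length ≤ n → (∀ w ∈ t, InSubspaceOn k X (Set.Iio n) w) →
        P (a ++ t) (shift n X') := by
  obtain ⟨V, hV, h⟩ := (DenseHereditary.forall_mem hk (fun t => hP (a ++ t))
    (finite_lists (finite_inSubspaceOn_Iio hk hX n) n)).exists_le _ (isBlockSeq_shift hX n)
  refine ⟨_, BlockLE.cat_le hk hX hV, fun i hi => cat_restrictN_of_lt _ _ hi, fun t ht ht' => ?_⟩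
  have := shift_cat (restrictN X n) V
  rw [length_restrictN] at this
  rw [this]
  exact h t ⟨ht, ht'⟩

theorem exists_fusion (hk : 1 ≤ k) {P : List (ℕ → ℕ) → (ℕ → ℕ → ℕ) → Prop}
    (hP : ∀ s, DenseHereditary k (P s)) (a : List (ℕ → ℕ)) {W : ℕ → ℕ → ℕ}
    (hW : IsBlockSeq k W) : ∃ Z, BlockLE k Z W ∧ ∀ Y, BlockLE k Y Z → ∀ j, ∃ m,
      BlockLE k (shift j Y) (shift m Z) ∧ P (a ++ restrictN Y j) (shift m Z) := by
  choose next hle heq hnext using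
    fun (X : {X : ℕ → ℕ → ℕ // IsBlockSeq k X}) n => exists_fusion_step hk hP a X.2 n
  let X : ℕ → {X : ℕ → ℕ → ℕ // IsBlockSeq k X} := fun n =>
    Nat.rec ⟨W, hW⟩ (fun n X => ⟨next X n, (hle X n).1⟩) n
  have hXle : ∀ n d, BlockLE k (X (d + n)).1 (X n).1 := by
    intro n d
    induction d with
    | zero => rw [Nat.zero_add]; exact BlockLE.refl (X n).2
    | succ d ih =>
      rw [Nat.add_right_comm]
      exact BlockLE.trans hk (X n).2 (hle (X (d + n)) (d + n)) ih
  have hXeq : ∀ n d, ∀ i < n, (X (d + n)).1 i = (X n).1 i := by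
    intro n d i hi
    induction d with
    | zero => rw [Nat.zero_add]
    | succ d ih =>
      rw [Nat.add_right_comm, ← ih]
      exact heq (X (d + n)) (d + n) i (by omega)
  let Z : ℕ → ℕ → ℕ := fun n => (X (n + 1)).1 n
  have hZeq : ∀ n, ∀ i < n, Z i = (X n).1 i := by
    intro n i hi
    obtain ⟨d, rfl⟩ := Nat.exists_eq_add_of_le' (Nat.succ_le_of_lt hi)
    exact (hXeq (i + 1) d i (Nat.lt_succ_self i)).symm
  have hZ : IsBlockSeq k Z := by
    refine ⟨fun n => (X (n + 1)).2.1 n, fun n => ?_⟩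
    rw [hZeq (n + 2) n (by omega), hZeq (n + 2) (n + 1) (by omega)]
    exact (X (n + 2)).2.2 n
  have hZX : ∀ n m, m ≤ n + 1 → BlockLE k (shift n Z) (shift n (X m).1) := by
    intro n m hm
    refine ⟨isBlockSeq_shift hZ n, fun i => ?_⟩
    obtain ⟨d, hd⟩ := Nat.exists_eq_add_of_le' (show m ≤ i + n + 1 by omega)
    have h := (BlockLE.shift_le hk (X m).2 (hXle m d) n).2 i
    rw [← hd] at h
    exact h
  refine ⟨Z, hZX 0 0 (by omega), fun Y hY j => ?_⟩
  obtain ⟨m, hjm, hm, hle'⟩ := BlockLE.exists_split hk hZ hY j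
  refine ⟨m, hle', (hP _).mono _ _ (isBlockSeq_shift (X (m + 1)).2 m) (hZX m (m + 1) le_rfl) ?_⟩
  refine hnext (X m) m _ (by simpa using hjm) fun w hw => ?_
  obtain ⟨i, hi, rfl⟩ := List.mem_map.1 hw
  exact inSubspaceOn_congr (fun i hi => hZeq m i hi) (hm i (List.mem_range.1 hi))

/-! ### Ramsey sets -/

/-- The sequences that start with `a` and continue with a block subsequence of `W`. -/
def Nbhd (k : ℕ) (a : List (ℕ → ℕ)) (W : ℕ → ℕ → ℕ) : Set (ℕ → ℕ → ℕ) :=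
  {Y | ∃ Z, BlockLE k Z W ∧ Y = cat a Z}

theorem nbhd_mono (hk : 1 ≤ k) {a : List (ℕ → ℕ)} {W Z : ℕ → ℕ → ℕ} (hW : IsBlockSeq k W)
    (h : BlockLE k Z W) : Nbhd k a Z ⊆ Nbhd k a W := by
  rintro _ ⟨V, hV, rfl⟩
  exact ⟨V, BlockLE.trans hk hW hV h, rfl⟩

theorem cat_mem_nbhd {a : List (ℕ → ℕ)} {W : ℕ → ℕ → ℕ} (hW : IsBlockSeq k W) :
    cat a W ∈ Nbhd k a W := ⟨W, BlockLE.refl hW, rfl⟩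

theorem mem_nbhd_of_shift {Y V : ℕ → ℕ → ℕ} {n : ℕ} (h : restrictN Y n = restrictN V n)
    (h' : BlockLE k (shift n Y) (shift n V)) : Y ∈ Nbhd k (restrictN V n) (shift n V) :=
  ⟨_, h', by rw [← h, cat_restrictN]⟩

theorem restrictN_eq_and_shift_le (hk : 1 ≤ k) {Y V : ℕ → ℕ → ℕ} {n m : ℕ} (hnm : n ≤ m)
    (hV : IsBlockSeq k (shift n V)) (h : Y ∈ Nbhd k (restrictN V m) (shift m V)) :
    restrictN Y n = restrictN V n ∧ BlockLE k (shift n Y) (shift n V) := by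
  obtain ⟨U, hU, rfl⟩ := h
  refine ⟨restrictN_cat_restrictN hnm V U, ?_⟩
  rw [shift_cat_restrictN hnm]
  refine BlockLE.cat_le hk hV ?_
  rwa [shift_shift, Nat.sub_add_cancel hnm]

theorem nbhd_anti (hk : 1 ≤ k) {V : ℕ → ℕ → ℕ} {n m : ℕ} (hnm : n ≤ m)
    (hV : IsBlockSeq k (shift n V)) :
    Nbhd k (restrictN V m) (shift m V) ⊆ Nbhd k (restrictN V n) (shift n V) := fun _ hY =>
  have h := restrictN_eq_and_shift_le hk hnm hV hY
  mem_nbhd_of_shift h.1 h.2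

/-- `M` is Ramsey: every neighbourhood can be thinned out into `M` or into its complement. -/
def IsRamsey (k : ℕ) (M : Set (ℕ → ℕ → ℕ)) : Prop :=
  ∀ a W, IsBlockSeq k W → ∃ Z, BlockLE k Z W ∧ (Nbhd k a Z ⊆ M ∨ Nbhd k a Z ⊆ Mᶜ)

/-- `M` is Ramsey null: every neighbourhood can be thinned out to avoid `M`. -/
def IsRamseyNull (k : ℕ) (M : Set (ℕ → ℕ → ℕ)) : Prop :=
  ∀ a W, IsBlockSeq k W → ∃ Z, BlockLE k Z W ∧ Nbhd k a Z ⊆ Mᶜ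

theorem IsRamseyNull.mono {M N : Set (ℕ → ℕ → ℕ)} (h : IsRamseyNull k N) (hMN : M ⊆ N) :
    IsRamseyNull k M := fun a W hW =>
  (h a W hW).imp fun _ hZ => ⟨hZ.1, hZ.2.trans (Set.compl_subset_compl.2 hMN)⟩

theorem IsRamseyNull.denseHereditary (hk : 1 ≤ k) {M : Set (ℕ → ℕ → ℕ)} (h : IsRamseyNull k M)
    (a : List (ℕ → ℕ)) : DenseHereditary k fun Z => Nbhd k a Z ⊆ Mᶜ :=
  ⟨fun _ _ hW hZ H => (nbhd_mono hk hW hZ).trans H, h a⟩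

theorem IsRamseyNull.iUnion (hk : 1 ≤ k) {M : ℕ → Set (ℕ → ℕ → ℕ)}
    (h : ∀ i, IsRamseyNull k (M i)) : IsRamseyNull k (⋃ i, M i) := by
  intro a W hW
  obtain ⟨Z, hZ, H⟩ := exists_fusion hk (P := fun s V => ∀ i ∈ Set.Iic s.length,
    Nbhd k s V ⊆ (M i)ᶜ) (fun s => DenseHereditary.forall_mem hk
      (fun i => (h i).denseHereditary hk s) (Set.finite_Iic _)) a hW
  refine ⟨Z, hZ, ?_⟩
  rintro _ ⟨Y, hY, rfl⟩ hM
  obtain ⟨i, hi⟩ := Set.mem_iUnion.1 hM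
  obtain ⟨m, hm, H⟩ := H Y hY i
  refine H i (by simp) ⟨_, hm, ?_⟩ hi
  rw [cat_append, cat_restrictN]

theorem IsRamsey.compl {M : Set (ℕ → ℕ → ℕ)} (h : IsRamsey k M) : IsRamsey k Mᶜ := fun a W hW =>
  (h a W hW).imp fun Z hZ => ⟨hZ.1, by rw [compl_compl]; exact hZ.2.symm⟩

theorem IsRamsey.inter (hk : 1 ≤ k) {M N : Set (ℕ → ℕ → ℕ)} (hM : IsRamsey k M)
    (hN : IsRamsey k N) : IsRamsey k (M ∩ N) := by
  intro a W hW
  obtain ⟨Z, hZ, h⟩ := hM a W hW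
  obtain ⟨V, hV, h'⟩ := hN a Z hZ.1
  refine ⟨V, BlockLE.trans hk hW hV hZ, ?_⟩
  have hVZ := nbhd_mono hk (a := a) hZ.1 hV
  rcases h with h | h
  · rcases h' with h' | h'
    · exact Or.inl (Set.subset_inter (hVZ.trans h) h')
    · exact Or.inr (h'.trans (Set.compl_subset_compl.2 Set.inter_subset_right))
  · exact Or.inr ((hVZ.trans h).trans (Set.compl_subset_compl.2 Set.inter_subset_left))

theorem IsRamsey.of_isRamseyNull_diff (hk : 1 ≤ k) {M N : Set (ℕ → ℕ → ℕ)} (hN : IsRamsey k N)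
    (hNM : N ⊆ M) (h : IsRamseyNull k (M \ N)) : IsRamsey k M := by
  intro a W hW
  obtain ⟨Z, hZ, h'⟩ := hN a W hW
  obtain ⟨V, hV, h''⟩ := h a Z hZ.1
  refine ⟨V, BlockLE.trans hk hW hV hZ, ?_⟩
  have hVZ := nbhd_mono hk (a := a) hZ.1 hV
  rcases h' with h' | h'
  · exact Or.inl ((hVZ.trans h').trans hNM)
  · exact Or.inr fun Y hY hYM => h'' hY ⟨hYM, h' (hVZ hY)⟩

/-! ### Open sets in the Ellentuck topology -/

/-- Openness with respect to the neighbourhoods `Nbhd`. -/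
def IsEllentuckOpen (k : ℕ) (O : Set (ℕ → ℕ → ℕ)) : Prop :=
  ∀ Y ∈ O, ∀ i, IsBlockSeq k (shift i Y) →
    ∃ n, i ≤ n ∧ Nbhd k (restrictN Y n) (shift n Y) ⊆ O

/-- No block subsequence of `W` yields a neighbourhood of `s` inside `O`. -/
def Rejects (k : ℕ) (O : Set (ℕ → ℕ → ℕ)) (s : List (ℕ → ℕ)) (W : ℕ → ℕ → ℕ) : Prop :=
  ∀ Z, BlockLE k Z W → ¬ Nbhd k s Z ⊆ O

theorem Rejects.mono (hk : 1 ≤ k) {O : Set (ℕ → ℕ → ℕ)} {s : List (ℕ → ℕ)} {W Z : ℕ → ℕ → ℕ}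
    (hW : IsBlockSeq k W) (hZ : BlockLE k Z W) (h : Rejects k O s W) : Rejects k O s Z :=
  fun V hV => h V (BlockLE.trans hk hW hV hZ)

theorem Rejects.of_shift (hk : 1 ≤ k) {O : Set (ℕ → ℕ → ℕ)} {s : List (ℕ → ℕ)} {W : ℕ → ℕ → ℕ}
    {n : ℕ} (hW : IsBlockSeq k W) (h : Rejects k O s (shift n W)) : Rejects k O s W :=
  fun _ hZ hO => h _ (BlockLE.shift_le hk hW hZ n)
    ((nbhd_mono hk hZ.1 (blockLE_shift hZ.1 n)).trans hO)

theorem denseHereditary_decides (hk : 1 ≤ k) (O : Set (ℕ → ℕ → ℕ)) (s : List (ℕ → ℕ)) :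
    DenseHereditary k fun W => Nbhd k s W ⊆ O ∨ Rejects k O s W := by
  refine ⟨fun W Z hW hZ h => h.imp (nbhd_mono hk hW hZ).trans (Rejects.mono hk hW hZ),
    fun W hW => ?_⟩
  by_cases h : Rejects k O s W
  · exact ⟨W, BlockLE.refl hW, Or.inr h⟩
  · simp only [Rejects, not_forall, not_not] at h
    obtain ⟨Z, hZ, h⟩ := h
    exact ⟨Z, hZ, Or.inl h⟩

theorem denseHereditary_rejects_succ (hk : 1 ≤ k) (O : Set (ℕ → ℕ → ℕ)) (s : List (ℕ → ℕ)) :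
    DenseHereditary k fun W => Nbhd k s W ⊆ O ∨
      Rejects k O s W ∧ ∀ w, InSubspace k W w → Rejects k O (s ++ [w]) W := by
  refine ⟨fun W Z hW hZ h => h.imp (nbhd_mono hk hW hZ).trans fun h => ⟨Rejects.mono hk hW hZ h.1,
    fun w hw => Rejects.mono hk hW hZ (h.2 w (BlockLE.inSubspace hk hW hZ hw))⟩, fun W hW => ?_⟩
  obtain ⟨V, hV, h⟩ := exists_fusion hk (denseHereditary_decides hk O) s hW
  obtain ⟨Z, hZ, hC⟩ := exists_homogeneous_subspace hk hV.1 {w | Rejects k O (s ++ [w]) V}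
  have hZW := BlockLE.trans hk hW hZ hV
  rcases hC with hC | hC
  · rcases (h Z hZ 0) with ⟨m, hm, hd⟩
    rw [show restrictN Z 0 = [] from rfl, List.append_nil] at hd
    have hVm := isBlockSeq_shift hV.1 m
    refine ⟨Z, hZW, hd.imp (nbhd_mono hk hVm hm).trans fun hd => ⟨Rejects.mono hk hVm hm hd,
      fun w hw => Rejects.mono hk hV.1 hZ (hC w hw)⟩⟩
  · refine ⟨Z, hZW, Or.inl ?_⟩
    rintro _ ⟨Y, hY, rfl⟩
    obtain ⟨m, hm, hd⟩ := h Y (BlockLE.trans hk hV.1 hY hZ) 1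
    rw [show restrictN Y 1 = [Y 0] from rfl] at hd
    refine hd.resolve_right (fun hd => hC _ (hY.2 0) (Rejects.of_shift hk hV.1 hd)) ⟨_, hm, ?_⟩
    rw [cat_append]
    exact congrArg (cat s) (cat_restrictN Y 1).symm

theorem IsEllentuckOpen.isRamsey (hk : 1 ≤ k) {O : Set (ℕ → ℕ → ℕ)} (hO : IsEllentuckOpen k O) :
    IsRamsey k O := by
  intro a W hW
  obtain ⟨Z, hZ, h⟩ := exists_fusion hk (denseHereditary_rejects_succ hk O) a hW
  have h : ∀ Y, BlockLE k Y Z → ∀ j, _ := fun Y hY j =>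
    let ⟨m, hm, hP⟩ := h Y hY j
    (denseHereditary_rejects_succ hk O (a ++ restrictN Y j)).mono _ _
      (isBlockSeq_shift hZ.1 m) hm hP
  by_cases ha : Nbhd k a Z ⊆ O
  · exact ⟨Z, hZ, Or.inl ha⟩
  refine ⟨Z, hZ, Or.inr ?_⟩
  rintro _ ⟨Y, hY, rfl⟩ hYO
  have hrej : ∀ j, Rejects k O (a ++ restrictN Y j) (shift j Y) := by
    intro j
    induction j with
    | zero =>
      have := h Z (BlockLE.refl hZ.1) 0
      rw [show restrictN Z 0 = [] from rfl, List.append_nil, shift_zero] at this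
      rw [show restrictN Y 0 = [] from rfl, List.append_nil, shift_zero]
      exact Rejects.mono hk hZ.1 hY (this.resolve_left ha).1
    | succ j ih =>
      have hYj := isBlockSeq_shift hY.1 j
      have := ((h Y hY j).resolve_left (ih _ (BlockLE.refl hYj))).2 _ (inSubspace_self _ 0)
      have hr : restrictN Y (j + 1) = restrictN Y j ++ [shift j Y 0] := by
        simp [restrictN, List.range_succ, shift]
      rw [hr, ← List.append_assoc, add_comm j 1, ← shift_shift]
      exact Rejects.mono hk hYj (blockLE_shift hYj 1) this
  obtain ⟨n, hn, hnO⟩ := hO _ hYO a.length (by rw [shift_cat]; exact hY.1)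
  obtain ⟨j, rfl⟩ := Nat.exists_eq_add_of_le' hn
  rw [restrictN_add_cat, shift_add_cat] at hnO
  exact hrej j _ (BlockLE.refl (isBlockSeq_shift hY.1 j)) hnO

/-- The interior with respect to the neighbourhoods `Nbhd`. -/
def ellentuckInterior (k : ℕ) (M : Set (ℕ → ℕ → ℕ)) : Set (ℕ → ℕ → ℕ) :=
  {Y | ∃ n, IsBlockSeq k (shift n Y) ∧ Nbhd k (restrictN Y n) (shift n Y) ⊆ M}

theorem ellentuckInterior_subset (M : Set (ℕ → ℕ → ℕ)) : ellentuckInterior k M ⊆ M := by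
  rintro Y ⟨n, hn, h⟩
  have := h (cat_mem_nbhd hn)
  rwa [cat_restrictN] at this

theorem nbhd_subset_ellentuckInterior (hk : 1 ≤ k) {M : Set (ℕ → ℕ → ℕ)} {a : List (ℕ → ℕ)}
    {W : ℕ → ℕ → ℕ} (hW : IsBlockSeq k W) (h : Nbhd k a W ⊆ M) :
    Nbhd k a W ⊆ ellentuckInterior k M := by
  rintro _ ⟨Z, hZ, rfl⟩
  refine ⟨a.length, ?_⟩
  rw [shift_cat, restrictN_cat]
  exact ⟨hZ.1, (nbhd_mono hk hW hZ).trans h⟩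

theorem isEllentuckOpen_ellentuckInterior (hk : 1 ≤ k) (M : Set (ℕ → ℕ → ℕ)) :
    IsEllentuckOpen k (ellentuckInterior k M) := by
  rintro Y ⟨n, hn, h⟩ i -
  refine ⟨max i n, le_max_left i n, (nbhd_anti hk (le_max_right i n) hn).trans ?_⟩
  exact nbhd_subset_ellentuckInterior hk hn h

theorem IsRamsey.isRamseyNull_diff_ellentuckInterior (hk : 1 ≤ k) {M N : Set (ℕ → ℕ → ℕ)}
    (h : IsRamsey k M) (hMN : M ⊆ N) : IsRamseyNull k (M \ ellentuckInterior k N) := by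
  intro a W hW
  obtain ⟨Z, hZ, h⟩ := h a W hW
  refine ⟨Z, hZ, ?_⟩
  rcases h with h | h
  · exact fun Y hY hY' => hY'.2 (nbhd_subset_ellentuckInterior hk hZ.1 (h.trans hMN) hY)
  · exact fun Y hY hY' => h hY hY'.1

theorem IsRamsey.iUnion (hk : 1 ≤ k) {M : ℕ → Set (ℕ → ℕ → ℕ)} (h : ∀ i, IsRamsey k (M i)) :
    IsRamsey k (⋃ i, M i) := by
  refine IsRamsey.of_isRamseyNull_diff hk
    (IsEllentuckOpen.isRamsey hk (isEllentuckOpen_ellentuckInterior hk (⋃ i, M i)))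
    (ellentuckInterior_subset _) ?_
  rw [Set.iUnion_sdiff]
  exact IsRamseyNull.iUnion hk fun i =>
    (h i).isRamseyNull_diff_ellentuckInterior hk (Set.subset_iUnion M i)

theorem IsRamsey.isRamseyNull (hk : 1 ≤ k) {D A : Set (ℕ → ℕ → ℕ)} (h : IsRamsey k D)
    (hDA : D ⊆ Aᶜ) (hD : D ⊆ (ellentuckInterior k Aᶜ)ᶜ) : IsRamseyNull k D := by
  intro a W hW
  obtain ⟨Z, hZ, h | h⟩ := h a W hW
  · have := nbhd_subset_ellentuckInterior hk hZ.1 (h.trans hDA) (cat_mem_nbhd hZ.1)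
    exact absurd this (hD (h (cat_mem_nbhd hZ.1)))
  · exact ⟨Z, hZ, h⟩

theorem IsRamsey.suslinOp (hk : 1 ≤ k) {P : List ℕ → Set (ℕ → ℕ → ℕ)}
    (hP : ∀ u, IsRamsey k (P u)) : IsRamsey k (SuslinOp P) := by
  let A : List ℕ → Set (ℕ → ℕ → ℕ) := fun u =>
    {Y | ∃ x : ℕ → ℕ, (List.range u.length).map x = u ∧ ∀ n, Y ∈ P ((List.range n).map x)}
  let Q : List ℕ → Set (ℕ → ℕ → ℕ) := fun u => P u ∩ (ellentuckInterior k (A u)ᶜ)ᶜ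
  let D : List ℕ → Set (ℕ → ℕ → ℕ) := fun u => Q u ∩ (⋃ i, Q (u ++ [i]))ᶜ
  have hQ : ∀ u, IsRamsey k (Q u) := fun u => (hP u).inter hk
    (IsEllentuckOpen.isRamsey hk (isEllentuckOpen_ellentuckInterior hk _)).compl
  have hAQ : ∀ u, A u ⊆ Q u := by
    rintro u Y ⟨x, hx, h⟩
    refine ⟨hx ▸ h u.length, fun hY => ellentuckInterior_subset _ hY ⟨x, hx, h⟩⟩
  have hD : ∀ u, IsRamseyNull k (D u) := by
    intro u
    refine IsRamsey.isRamseyNull hk ((hQ u).inter hk (IsRamsey.iUnion hk fun i => hQ _).compl)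
      (A := A u) ?_ fun Y hY => hY.1.2
    rintro Y hY ⟨x, hx, h⟩
    refine hY.2 (Set.mem_iUnion.2 ⟨x u.length, hAQ _ ⟨x, ?_, h⟩⟩)
    simp [List.range_succ, hx]
  have hA : SuslinOp P = A [] := by
    ext Y
    simp [SuslinOp, A]
  have hnull : IsRamseyNull k (Q [] \ SuslinOp P) := by
    refine (IsRamseyNull.iUnion hk fun n => hD (Denumerable.ofNat (List ℕ) n)).mono ?_
    rintro Y ⟨hY, hYS⟩
    by_contra hYD
    have hYD : ∀ u, Y ∉ D u := fun u hu =>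
      hYD (Set.mem_iUnion.2 ⟨Encodable.encode u, by rwa [Denumerable.ofNat_encode]⟩)
    have hstep : ∀ u, Y ∈ Q u → ∃ i, Y ∈ Q (u ++ [i]) := by
      intro u hu
      by_contra h
      exact hYD u ⟨hu, fun h' => h (Set.mem_iUnion.1 h')⟩
    choose! next hnext using hstep
    let u : ℕ → List ℕ := fun n => Nat.rec [] (fun _ u => u ++ [next u]) n
    have hu : ∀ n, Y ∈ Q (u n) := fun n => by
      induction n with
      | zero => exact hY
      | succ n ih => exact hnext _ ih
    have hux : ∀ n, (List.range n).map (fun n => next (u n)) = u n := fun n => by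
      induction n with
      | zero => rfl
      | succ n ih => rw [List.range_succ, List.map_append, ih]; rfl
    refine hYS (Set.mem_iUnion.2 ⟨fun n => next (u n), Set.mem_iInter.2 fun n => ?_⟩)
    rw [hux]
    exact (hu n).1
  rw [← compl_compl (SuslinOp P)]
  refine (IsRamsey.of_isRamseyNull_diff hk (hQ []).compl
    (Set.compl_subset_compl.2 (hA ▸ hAQ [])) ?_).compl
  rwa [Set.sdiff_compl, Set.inter_comm, ← Set.sdiff_eq]

theorem isEllentuckOpen_of_isOpen (hk : 1 ≤ k) {O : Set (ℕ → ℕ → ℕ)}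
    (hO : @IsOpen _ (finkTop k) O) : IsEllentuckOpen k O := by
  induction hO with
  | basic B hB =>
    obtain ⟨s, X, hX, -, rfl⟩ := hB
    rintro Y ⟨hY, hYs⟩ i -
    refine ⟨max i s.length, le_max_left _ _, fun V hV => ⟨?_, ?_⟩⟩
    · have := (restrictN_eq_and_shift_le hk (Nat.zero_le _) hY.1 hV).2
      exact BlockLE.trans hk hX this hY
    · exact (restrictN_eq_and_shift_le hk (le_max_right _ _)
        (isBlockSeq_shift hY.1 _) hV).1.trans hYs
  | univ => exact fun Y _ i _ => ⟨i, le_rfl, Set.subset_univ _⟩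
  | inter U V _ _ ihU ihV =>
    rintro Y ⟨hU, hV⟩ i hi
    obtain ⟨n, hn, h⟩ := ihU Y hU i hi
    obtain ⟨m, hm, h'⟩ := ihV Y hV i hi
    have hs : ∀ j, i ≤ j → IsBlockSeq k (shift j Y) := fun j hj => by
      have := isBlockSeq_shift hi (j - i)
      rwa [shift_shift, Nat.sub_add_cancel hj] at this
    exact ⟨max n m, hn.trans (le_max_left _ _), Set.subset_inter
      ((nbhd_anti hk (le_max_left _ _) (hs n hn)).trans h)
      ((nbhd_anti hk (le_max_right _ _) (hs m hm)).trans h')⟩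
  | sUnion S _ ih =>
    rintro Y ⟨U, hUS, hYU⟩ i hi
    obtain ⟨n, hn, h⟩ := ih U hUS Y hYU i hi
    exact ⟨n, hn, h.trans (Set.subset_sUnion_of_mem hUS)⟩

theorem isRamsey_of_inSuslinField (hk : 1 ≤ k) {M : Set (ℕ → ℕ → ℕ)}
    (hM : InSuslinField (finkTop k) M) : IsRamsey k M := by
  induction hM with
  | closed s hs =>
    rw [← compl_compl s]
    exact ((isEllentuckOpen_of_isOpen hk hs.isOpen_compl).isRamsey hk).compl
  | compl s _ ih => exact ih.compl
  | iUnion g _ ih => exact IsRamsey.iUnion hk ih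
  | suslin P _ ih => exact IsRamsey.suslinOp hk ih

theorem exists_constant_on_nbhd (hk : 1 ≤ k) (c : (ℕ → ℕ → ℕ) → ℕ)
    (hc : ∀ i, IsRamsey k (c ⁻¹' {i})) (a : List (ℕ → ℕ)) (l : ℕ) {W : ℕ → ℕ → ℕ}
    (hW : IsBlockSeq k W) : ∃ Z, BlockLE k Z W ∧
      ((∃ i, ∀ Y ∈ Nbhd k a Z, c Y = i) ∨ ∀ Y ∈ Nbhd k a Z, l ≤ c Y) := by
  induction l with
  | zero => exact ⟨W, BlockLE.refl hW, Or.inr fun _ _ => Nat.zero_le _⟩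
  | succ l ih =>
    obtain ⟨Z, hZ, ⟨i, h⟩ | h⟩ := ih
    · exact ⟨Z, hZ, Or.inl ⟨i, h⟩⟩
    obtain ⟨V, hV, h' | h'⟩ := hc l a Z hZ.1
    · exact ⟨V, BlockLE.trans hk hW hV hZ, Or.inl ⟨l, h'⟩⟩
    · refine ⟨V, BlockLE.trans hk hW hV hZ, Or.inr fun Y hY => ?_⟩
      exact Nat.lt_of_le_of_ne (h Y (nbhd_mono hk hZ.1 hV hY)) (Ne.symm (h' hY))

end BlockSpace

/-- Finite Suslin-measurable colorings of `[s, X]` are constant on `[s, Y]` for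
some `Y ∈ [s, X]`. -/
theorem statement2 (k : ℕ) (hk : 1 ≤ k) (X : ℕ → ℕ → ℕ) (hX : IsBlockSeq k X)
    (s : List (ℕ → ℕ)) (hs : s ∈ Approx k X) (l : ℕ) (c : (ℕ → ℕ → ℕ) → ℕ)
    (hl : ∀ Y, BlockLE k Y X → restrictN Y s.length = s → c Y < l)
    (hc : ∀ A : Set ℕ, InSuslinField (finkTop k) (c ⁻¹' A)) :
    ∃ Y, BlockLE k Y X ∧ restrictN Y s.length = s ∧
      ∀ Z, BlockLE k Z Y → restrictN Z s.length = s →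
      ∀ Z', BlockLE k Z' Y → restrictN Z' s.length = s → c Z = c Z' := by
  open BlockSpace in
  obtain ⟨n, Y₀, hY₀, rfl⟩ := Set.mem_iUnion.1 hs
  rw [length_restrictN] at hl ⊢
  obtain ⟨Z, hZ, h⟩ := exists_constant_on_nbhd hk c
    (fun i => isRamsey_of_inSuslinField hk (hc {i})) (restrictN Y₀ n) l (isBlockSeq_shift hY₀.1 n)
  have hle := BlockLE.cat_le hk hY₀.1 hZ
  have hlX := BlockLE.trans hk hX hle hY₀
  have hr := restrictN_cat (restrictN Y₀ n) Z
  rw [length_restrictN] at hr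
  have hmem : ∀ V, BlockLE k V (cat (restrictN Y₀ n) Z) → restrictN V n = restrictN Y₀ n →
      V ∈ Nbhd k (restrictN Y₀ n) Z := by
    intro V hV hVn
    have hs := BlockLE.shift_le hk hle.1 hV n
    have hc := shift_cat (restrictN Y₀ n) Z
    rw [length_restrictN] at hc
    rw [hc] at hs
    exact ⟨_, hs, by rw [← hVn, cat_restrictN]⟩
  refine ⟨_, hlX, hr, fun V hV hVn V' hV' hVn' => ?_⟩
  rcases h with ⟨i, h⟩ | h
  · rw [h V (hmem V hV hVn), h V' (hmem V' hV' hVn')]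
  · exact absurd (h _ (cat_mem_nbhd hZ.1)) (hl _ hlX hr).not_ge
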